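/- arXiv:1403.2512 — 2 statements merged into one kernel-verified Lean document; each statement's English description precedes it below -/
import Mathlib

section
/- The set of P-positions of Wythoff's game is {(A_n, B_n) : n ≥ 0} ∪ {(B_n, A_n) : n ≥ 0}. -/
noncomputable def phi : ℝ := (1 + Real.sqrt 5) / 2
noncomputable def wA (n : ℕ) : ℕ := ⌊phi * n⌋₊
noncomputable def wB (n : ℕ) : ℕ := ⌊phi ^ 2 * n⌋₊

/-- A legal move in Wythoff's game from `p` to `q`. -/
def WythoffMove (p q : ℕ × ℕ) : Prop :=
  (∃ t, 1 ≤ t ∧ t ≤ p.1 ∧ q = (p.1 - t, p.2)) ∨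
  (∃ t, 1 ≤ t ∧ t ≤ p.2 ∧ q = (p.1, p.2 - t)) ∨
  (∃ s, 1 ≤ s ∧ s ≤ min p.1 p.2 ∧ q = (p.1 - s, p.2 - s))

/-- `S` is the set of P-positions of the game with move relation `move`. -/
def IsPPositions (move : ℕ × ℕ → ℕ × ℕ → Prop) (S : Set (ℕ × ℕ)) : Prop :=
  (∀ p ∈ S, ∀ q ∈ S, ¬ move p q) ∧ (∀ p ∉ S, ∃ q ∈ S, move p q)

theorem phi_sq : phi ^ 2 = phi + 1 := Real.goldenRatio_sq

theorem one_lt_phi : 1 < phi := Real.one_lt_goldenRatio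

theorem wB_eq_wA_add (n : ℕ) : wB n = wA n + n := by
  have h : 0 ≤ phi * n := mul_nonneg (by linarith [one_lt_phi]) n.cast_nonneg
  rw [wB, wA, phi_sq, add_mul, one_mul, Nat.floor_add_natCast h]

theorem wA_strictMono : StrictMono wA := by
  refine strictMono_nat_of_lt_succ fun n => ?_
  have h : 0 ≤ phi * n := mul_nonneg (by linarith [one_lt_phi]) n.cast_nonneg
  rw [wA, wA, ← Nat.succ_le_iff, Nat.succ_eq_add_one, ← Nat.floor_add_one h]
  apply Nat.floor_le_floor
  push_cast
  linarith [one_lt_phi]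

theorem wA_zero : wA 0 = 0 := by simp [wA]

theorem natCast_wA (n : ℕ) : (wA n : ℤ) = beattySeq phi n := by
  have h : 0 ≤ phi * n := mul_nonneg (by linarith [one_lt_phi]) n.cast_nonneg
  rw [wA, beattySeq, Int.natCast_floor_eq_floor h, mul_comm, Int.cast_natCast]

theorem natCast_wB (n : ℕ) : (wB n : ℤ) = beattySeq (phi ^ 2) n := by
  have h : 0 ≤ phi ^ 2 * n := by positivity
  rw [wB, beattySeq, Int.natCast_floor_eq_floor h, mul_comm, Int.cast_natCast]

theorem phi_holderConjugate : phi.HolderConjugate (phi ^ 2) := by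
  have h := one_lt_phi
  rw [Real.holderConjugate_iff]
  refine ⟨h, ?_⟩
  field_simp
  linarith [phi_sq]

/-- The positive values of the lower and upper Wythoff sequences partition the positive integers. -/
theorem wythoff_symmDiff :
    symmDiff {x : ℤ | ∃ k > 0, beattySeq phi k = x} {x | ∃ k > 0, beattySeq (phi ^ 2) k = x} =
      {n | 0 < n} :=
  Irrational.beattySeq_symmDiff_beattySeq_pos phi_holderConjugate Real.goldenRatio_irrational

theorem exists_wA_or_wB (a : ℕ) : (∃ n, a = wA n) ∨ ∃ n, a = wB n := by
  rcases Nat.eq_zero_or_pos a with rfl | ha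
  · exact Or.inl ⟨0, wA_zero.symm⟩
  have h : (a : ℤ) ∈ {n : ℤ | 0 < n} := Int.natCast_pos.2 ha
  rw [← wythoff_symmDiff] at h
  rcases h with ⟨⟨k, hk, h⟩, -⟩ | ⟨⟨k, hk, h⟩, -⟩ <;> lift k to ℕ using hk.le
  · exact Or.inl ⟨k, by rw [← natCast_wA] at h; exact_mod_cast h.symm⟩
  · exact Or.inr ⟨k, by rw [← natCast_wB] at h; exact_mod_cast h.symm⟩

theorem eq_zero_of_wA_eq_wB {n m : ℕ} (h : wA n = wB m) : n = 0 ∧ m = 0 := by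
  have hA := wA_strictMono.le_apply (x := n)
  have hB := wB_eq_wA_add m
  rcases Nat.eq_zero_or_pos n with rfl | hn
  · rw [wA_zero] at h
    omega
  have hm0 : 0 < m := by
    rcases Nat.eq_zero_or_pos m with rfl | hm0
    · rw [wA_zero] at hB
      omega
    · exact hm0
  have hpos : (wA n : ℤ) ∈ {n : ℤ | 0 < n} := Int.natCast_pos.2 (by omega)
  rw [← wythoff_symmDiff] at hpos
  have h₁ : (wA n : ℤ) ∈ {x : ℤ | ∃ k > 0, beattySeq phi k = x} :=
    ⟨n, by exact_mod_cast hn, (natCast_wA n).symm⟩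
  have h₂ : (wA n : ℤ) ∈ {x : ℤ | ∃ k > 0, beattySeq (phi ^ 2) k = x} :=
    ⟨m, by exact_mod_cast hm0, by rw [h, natCast_wB]⟩
  rcases hpos with ⟨-, h'⟩ | ⟨-, h'⟩
  · exact absurd h₂ h'
  · exact absurd h₁ h'

theorem WythoffMove.sum_lt {p q : ℕ × ℕ} (h : WythoffMove p q) : q.1 + q.2 < p.1 + p.2 := by
  rcases h with ⟨t, h₁, h₂, rfl⟩ | ⟨t, h₁, h₂, rfl⟩ | ⟨t, h₁, h₂, rfl⟩ <;> dsimp only <;> omega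

theorem WythoffMove.swap {p q : ℕ × ℕ} (h : WythoffMove p q) : WythoffMove p.swap q.swap := by
  rcases h with ⟨t, h₁, h₂, rfl⟩ | ⟨t, h₁, h₂, rfl⟩ | ⟨t, h₁, h₂, rfl⟩
  · exact Or.inr (Or.inl ⟨t, h₁, h₂, rfl⟩)
  · exact Or.inl ⟨t, h₁, h₂, rfl⟩
  · exact Or.inr (Or.inr ⟨t, h₁, by rwa [min_comm] at h₂, rfl⟩)

theorem IsPPositions.unique {move : ℕ × ℕ → ℕ × ℕ → Prop} (f : ℕ × ℕ → ℕ)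
    (hf : ∀ p q, move p q → f q < f p) {S T : Set (ℕ × ℕ)} (hS : IsPPositions move S)
    (hT : IsPPositions move T) : S = T := by
  ext p
  induction hn : f p using Nat.strong_induction_on generalizing p with
  | _ n ih =>
    subst hn
    constructor
    · intro hp
      by_contra hpT
      obtain ⟨q, hq, hm⟩ := hT.2 p hpT
      exact hS.1 p hp q ((ih _ (hf p q hm) q rfl).2 hq) hm
    · intro hp
      by_contra hpS
      obtain ⟨q, hq, hm⟩ := hS.2 p hpS
      exact hT.1 p hp q ((ih _ (hf p q hm) q rfl).1 hq) hm

/-- The set of positions `(wA n, wB n)` and `(wB n, wA n)`. -/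
def wythoffPairs : Set (ℕ × ℕ) :=
  {p : ℕ × ℕ | ∃ n, p = (wA n, wB n)} ∪ {p : ℕ × ℕ | ∃ n, p = (wB n, wA n)}

theorem swap_mem_wythoffPairs {p : ℕ × ℕ} (h : p ∈ wythoffPairs) : p.swap ∈ wythoffPairs := by
  rcases h with ⟨n, rfl⟩ | ⟨n, rfl⟩
  · exact Or.inr ⟨n, rfl⟩
  · exact Or.inl ⟨n, rfl⟩

theorem not_wythoffMove_of_mem_wythoffPairs {n : ℕ} {q : ℕ × ℕ} (hq : q ∈ wythoffPairs) :
    ¬ WythoffMove (wA n, wB n) q := by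
  intro h
  have hn := wB_eq_wA_add n
  rcases hq with ⟨m, rfl⟩ | ⟨m, rfl⟩ <;> have hm := wB_eq_wA_add m
  · have hne : n ≠ m := by
      rintro rfl
      exact lt_irrefl _ h.sum_lt
    have hA : wA n ≠ wA m := fun h => hne (wA_strictMono.injective h)
    have hB : wB n ≠ wB m := by
      rcases lt_or_gt_of_ne hne with h | h <;> have := wA_strictMono h <;> omega
    simp only [WythoffMove, Prod.mk.injEq] at h
    omega
  · have h₁ := @eq_zero_of_wA_eq_wB n m
    have h₂ := @eq_zero_of_wA_eq_wB m n
    have hzero : ¬ (n = 0 ∧ m = 0) := by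
      rintro ⟨rfl, rfl⟩
      have := h.sum_lt
      dsimp only at this
      omega
    simp only [WythoffMove, Prod.mk.injEq] at h
    omega

theorem exists_wythoffMove_of_le {a b : ℕ} (hab : a ≤ b) (h : (a, b) ∉ wythoffPairs) :
    ∃ q ∈ wythoffPairs, WythoffMove (a, b) q := by
  rcases exists_wA_or_wB a with ⟨n, rfl⟩ | ⟨n, rfl⟩ <;> have hn := wB_eq_wA_add n
  · rcases lt_trichotomy b (wB n) with hb | rfl | hb
    · have hlt : b - wA n < n := by omega
      have hA := wA_strictMono hlt
      have hB := wB_eq_wA_add (b - wA n)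
      refine ⟨_, Or.inl ⟨b - wA n, rfl⟩, Or.inr (Or.inr ⟨wA n - wA (b - wA n), ?_, ?_, ?_⟩)⟩
      · omega
      · dsimp only
        omega
      · ext <;> dsimp only <;> omega
    · exact absurd (Or.inl ⟨n, rfl⟩) h
    · refine ⟨_, Or.inl ⟨n, rfl⟩, Or.inr (Or.inl ⟨b - wB n, ?_, ?_, ?_⟩)⟩
      · omega
      · dsimp only
        omega
      · ext <;> dsimp only
        omega
  · have hb : b ≠ wA n := by
      rintro rfl
      exact h (Or.inr ⟨n, rfl⟩)
    refine ⟨_, Or.inr ⟨n, rfl⟩, Or.inr (Or.inl ⟨b - wA n, ?_, ?_, ?_⟩)⟩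
    · omega
    · dsimp only
      omega
    · ext <;> dsimp only
      omega

theorem isPPositions_wythoffPairs : IsPPositions WythoffMove wythoffPairs := by
  constructor
  · rintro p (⟨n, rfl⟩ | ⟨n, rfl⟩) q hq h
    · exact not_wythoffMove_of_mem_wythoffPairs hq h
    · exact not_wythoffMove_of_mem_wythoffPairs (swap_mem_wythoffPairs hq) h.swap
  · rintro ⟨a, b⟩ h
    rcases le_total a b with hab | hab
    · exact exists_wythoffMove_of_le hab h
    · obtain ⟨q, hq, hm⟩ := exists_wythoffMove_of_le hab fun h' => h (swap_mem_wythoffPairs h')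
      exact ⟨q.swap, swap_mem_wythoffPairs hq, hm.swap⟩

theorem wythoff_P_positions (S : Set (ℕ × ℕ)) :
    IsPPositions WythoffMove S ↔
      S = {p : ℕ × ℕ | ∃ n, p = (wA n, wB n)} ∪ {p : ℕ × ℕ | ∃ n, p = (wB n, wA n)} := by
  constructor
  · exact fun hS => hS.unique (fun p => p.1 + p.2) (fun _ _ => WythoffMove.sum_lt)
      isPPositions_wythoffPairs
  · rintro rfl
    exact isPPositions_wythoffPairs
end

section
/- Let k ≥ 0 be an integer, and let S¹_k and S¹_{k+2} denote the sets of positions with Sprague–Grundy value 1 in the games W_k and W_{k+2} respectively. Then S¹_{k+2} = {(0,1), (1,0)} ∪ {(a+2, b+2) : (a,b) ∈ S¹_k}. -/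
/-- A legal move in the game `W_k` from `p` to `q`: a Nim move, or a diagonal move
whose resulting smaller entry is at least `k`. -/
def WkMove (k : ℕ) (p q : ℕ × ℕ) : Prop :=
  (∃ t, 1 ≤ t ∧ t ≤ p.1 ∧ q = (p.1 - t, p.2)) ∨
  (∃ t, 1 ≤ t ∧ t ≤ p.2 ∧ q = (p.1, p.2 - t)) ∨
  (∃ s, 1 ≤ s ∧ s ≤ min p.1 p.2 ∧ k ≤ min (p.1 - s) (p.2 - s) ∧ q = (p.1 - s, p.2 - s))

/-- `G` is the Sprague–Grundy function of the game with move relation `move`: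
at every position, `G` takes the mex of the values of the options. -/
def IsGrundy (move : ℕ × ℕ → ℕ × ℕ → Prop) (G : ℕ × ℕ → ℕ) : Prop :=
  ∀ p, (∀ q, move p q → G q ≠ G p) ∧ (∀ v, v < G p → ∃ q, move p q ∧ G q = v)

namespace IsGrundy

variable {move : ℕ × ℕ → ℕ × ℕ → Prop} {G : ℕ × ℕ → ℕ}

theorem eq_zero_iff (h : IsGrundy move G) (p : ℕ × ℕ) :
    G p = 0 ↔ ∀ q, move p q → G q ≠ 0 := by
  refine ⟨fun h0 q hq => h0 ▸ (h p).1 q hq, fun hp => ?_⟩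
  by_contra hne
  obtain ⟨q, hq, h0⟩ := (h p).2 0 (Nat.pos_of_ne_zero hne)
  exact hp q hq h0

theorem eq_one_iff (h : IsGrundy move G) (p : ℕ × ℕ) :
    G p = 1 ↔ (∃ q, move p q ∧ G q = 0) ∧ ∀ q, move p q → G q ≠ 1 := by
  constructor
  · intro h1
    exact ⟨(h p).2 0 (by omega), fun q hq => h1 ▸ (h p).1 q hq⟩
  · rintro ⟨⟨q, hq, h0⟩, hp⟩
    have hne : G p ≠ 0 := fun hz => (h.eq_zero_iff p).1 hz q hq h0
    by_contra hne1
    obtain ⟨r, hr, h1⟩ := (h p).2 1 (by omega)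
    exact hp r hr h1

theorem two_le (h : IsGrundy move G) {p q r : ℕ × ℕ} (hq : move p q) (hr : move p r)
    (h0 : G q = 0) (h1 : G r = 1) : 2 ≤ G p := by
  have := (h p).1 q hq
  have := (h p).1 r hr
  omega

end IsGrundy

theorem WkMove.left {k a b c : ℕ} (h : c < a) : WkMove k (a, b) (c, b) :=
  Or.inl ⟨a - c, by omega, by simp, by ext <;> simp; omega⟩

theorem WkMove.right {k a b c : ℕ} (h : c < b) : WkMove k (a, b) (a, c) :=
  Or.inr (Or.inl ⟨b - c, by omega, by simp, by ext <;> simp; omega⟩)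

theorem wkMove_iff {k a b c d : ℕ} :
    WkMove k (a, b) (c, d) ↔
      (c < a ∧ d = b) ∨ (c = a ∧ d < b) ∨ (c < a ∧ a + d = b + c ∧ k ≤ c ∧ k ≤ d) := by
  constructor
  · rintro (⟨t, h1, h2, h⟩ | ⟨t, h1, h2, h⟩ | ⟨t, h1, h2, h3, h⟩) <;>
      simp only [Prod.mk.injEq] at * <;> omega
  · rintro (⟨h, rfl⟩ | ⟨rfl, h⟩ | ⟨h1, h2, h3, h4⟩)
    · exact .left h
    · exact .right h
    · exact Or.inr (Or.inr ⟨a - c, by omega, by omega, by omega, Prod.ext (by omega) (by omega)⟩)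

theorem wkMove_add_two_iff {k a b c d : ℕ} :
    WkMove (k + 2) (a + 2, b + 2) (c + 2, d + 2) ↔ WkMove k (a, b) (c, d) := by
  simp only [wkMove_iff]
  omega

section Boundary

variable {k : ℕ} {G : ℕ × ℕ → ℕ}

theorem grundy_zero_zero (hG : IsGrundy (WkMove (k + 2)) G) : G (0, 0) = 0 := by
  rw [hG.eq_zero_iff]
  rintro ⟨c, d⟩ h
  rw [wkMove_iff] at h
  omega

theorem grundy_zero_one (hG : IsGrundy (WkMove (k + 2)) G) : G (0, 1) = 1 := by
  rw [hG.eq_one_iff]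
  refine ⟨⟨(0, 0), .right one_pos, grundy_zero_zero hG⟩, ?_⟩
  rintro ⟨c, d⟩ h
  rw [wkMove_iff] at h
  obtain ⟨rfl, rfl⟩ : c = 0 ∧ d = 0 := by omega
  simp [grundy_zero_zero hG]

theorem grundy_one_zero (hG : IsGrundy (WkMove (k + 2)) G) : G (1, 0) = 1 := by
  rw [hG.eq_one_iff]
  refine ⟨⟨(0, 0), .left one_pos, grundy_zero_zero hG⟩, ?_⟩
  rintro ⟨c, d⟩ h
  rw [wkMove_iff] at h
  obtain ⟨rfl, rfl⟩ : c = 0 ∧ d = 0 := by omega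
  simp [grundy_zero_zero hG]

theorem grundy_one_one (hG : IsGrundy (WkMove (k + 2)) G) : G (1, 1) = 0 := by
  rw [hG.eq_zero_iff]
  rintro ⟨c, d⟩ h
  rw [wkMove_iff] at h
  obtain ⟨rfl, rfl⟩ | ⟨rfl, rfl⟩ : (c = 0 ∧ d = 1) ∨ (c = 1 ∧ d = 0) := by omega
  · simp [grundy_zero_one hG]
  · simp [grundy_one_zero hG]

theorem two_le_grundy_of_left_lt_two (hG : IsGrundy (WkMove (k + 2)) G)
    {c : ℕ} (hc : c < 2) (b : ℕ) : 2 ≤ G (c, b + 2) := by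
  interval_cases c
  · exact hG.two_le (.right (by omega)) (.right (by omega))
      (grundy_zero_zero hG) (grundy_zero_one hG)
  · exact hG.two_le (.right (by omega)) (.right (by omega))
      (grundy_one_one hG) (grundy_one_zero hG)

theorem two_le_grundy_of_right_lt_two (hG : IsGrundy (WkMove (k + 2)) G)
    {d : ℕ} (hd : d < 2) (a : ℕ) : 2 ≤ G (a + 2, d) := by
  interval_cases d
  · exact hG.two_le (.left (by omega)) (.left (by omega))
      (grundy_zero_zero hG) (grundy_one_zero hG)
  · exact hG.two_le (.left (by omega)) (.left (by omega))
      (grundy_one_one hG) (grundy_zero_one hG)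

/-- Moves from a translated position to an option of value less than two stay among the
translated positions. -/
theorem exists_move_add_two_iff (hG : IsGrundy (WkMove (k + 2)) G)
    {a b v : ℕ} (hv : v < 2) :
    (∃ q, WkMove (k + 2) (a + 2, b + 2) q ∧ G q = v) ↔
      ∃ c d, WkMove k (a, b) (c, d) ∧ G (c + 2, d + 2) = v := by
  constructor
  · rintro ⟨⟨c, d⟩, h, hGv⟩
    have h' := wkMove_iff.1 h
    rcases lt_or_ge c 2 with hc | hc
    · obtain rfl : d = b + 2 := by omega
      have := two_le_grundy_of_left_lt_two hG hc b
      omega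
    rcases lt_or_ge d 2 with hd | hd
    · obtain rfl : c = a + 2 := by omega
      have := two_le_grundy_of_right_lt_two hG hd a
      omega
    obtain ⟨c, rfl⟩ := Nat.exists_eq_add_of_le' hc
    obtain ⟨d, rfl⟩ := Nat.exists_eq_add_of_le' hd
    exact ⟨c, d, wkMove_add_two_iff.1 h, hGv⟩
  · rintro ⟨c, d, h, hGv⟩
    exact ⟨_, wkMove_add_two_iff.2 h, hGv⟩

end Boundary

theorem grundy_add_two_iff {k : ℕ} {G G' : ℕ × ℕ → ℕ}
    (hG : IsGrundy (WkMove k) G) (hG' : IsGrundy (WkMove (k + 2)) G') (a b : ℕ) :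
    (G' (a + 2, b + 2) = 0 ↔ G (a, b) = 0) ∧ (G' (a + 2, b + 2) = 1 ↔ G (a, b) = 1) := by
  induction hn : a + b using Nat.strong_induction_on generalizing a b with
  | _ n ih =>
    have ih' : ∀ c d, WkMove k (a, b) (c, d) →
        (G' (c + 2, d + 2) = 0 ↔ G (c, d) = 0) ∧ (G' (c + 2, d + 2) = 1 ↔ G (c, d) = 1) := by
      intro c d h
      rw [wkMove_iff] at h
      exact ih (c + d) (by omega) c d rfl
    have h0 : (∃ q, WkMove (k + 2) (a + 2, b + 2) q ∧ G' q = 0) ↔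
        ∃ q, WkMove k (a, b) q ∧ G q = 0 := by
      rw [exists_move_add_two_iff hG' two_pos, Prod.exists]
      exact exists₂_congr fun c d => and_congr_right fun h => (ih' c d h).1
    have h1 : (∃ q, WkMove (k + 2) (a + 2, b + 2) q ∧ G' q = 1) ↔
        ∃ q, WkMove k (a, b) q ∧ G q = 1 := by
      rw [exists_move_add_two_iff hG' one_lt_two, Prod.exists]
      exact exists₂_congr fun c d => and_congr_right fun h => (ih' c d h).2
    have h0' := not_congr h0
    have h1' := not_congr h1
    simp only [not_exists, not_and] at h0' h1'
    rw [hG.eq_zero_iff, hG'.eq_zero_iff, hG.eq_one_iff, hG'.eq_one_iff]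
    exact ⟨h0', and_congr h0 h1'⟩

theorem Wk_grundy_one_translation (k : ℕ) (G G' : ℕ × ℕ → ℕ)
    (hG : IsGrundy (WkMove k) G) (hG' : IsGrundy (WkMove (k + 2)) G') :
    {p : ℕ × ℕ | G' p = 1} =
      ({((0 : ℕ), (1 : ℕ)), ((1 : ℕ), (0 : ℕ))} : Set (ℕ × ℕ)) ∪
      {p : ℕ × ℕ | ∃ a b, G (a, b) = 1 ∧ p = (a + 2, b + 2)} := by
  have h00 := grundy_zero_zero hG'
  have h11 := grundy_one_one hG'
  ext ⟨x, y⟩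
  simp only [Set.mem_ofPred_eq, Set.mem_union, Set.mem_insert_iff, Set.mem_singleton_iff]
  constructor
  · intro h
    match x, y with
    | 0, 0 => omega
    | 0, 1 => simp
    | 1, 0 => simp
    | 1, 1 => omega
    | 0, b + 2 => have := two_le_grundy_of_left_lt_two hG' two_pos b; omega
    | 1, b + 2 => have := two_le_grundy_of_left_lt_two hG' one_lt_two b; omega
    | a + 2, 0 => have := two_le_grundy_of_right_lt_two hG' two_pos a; omega
    | a + 2, 1 => have := two_le_grundy_of_right_lt_two hG' one_lt_two a; omega
    | a + 2, b + 2 => exact Or.inr ⟨a, b, (grundy_add_two_iff hG hG' a b).2.1 h, rfl⟩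
  · rintro ((h | h) | ⟨a, b, h, hp⟩)
    · rw [h, grundy_zero_one hG']
    · rw [h, grundy_one_zero hG']
    · rw [hp, (grundy_add_two_iff hG hG' a b).2.2 h]
end
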